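/- Let (X,f) be a dynamical system. Then (K(X), f̄) is sensitively dependent on initial conditions if and only if Zadeh's extension f̃ on (F^1(X), d_∞) is sensitively dependent on initial conditions. -/

import Mathlib

noncomputable section

open Set Metric

/-- The unit interval `I = [0,1]` as a subset of `ℝ`. -/
def I01 : Set ℝ := Set.Icc 0 1

/-- `g ∈ D_m(I)`: `g : I → I` is nondecreasing, right-continuous, `g 0 = 0`, `g 1 = 1`. -/
def Dm (g : ℝ → ℝ) : Prop :=
  MonotoneOn g I01 ∧
  (∀ x ∈ I01, ContinuousWithinAt g (I01 ∩ Set.Ici x) x) ∧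
  Set.MapsTo g I01 I01 ∧ g 0 = 0 ∧ g 1 = 1

/-- `ξ_g x = min g⁻¹([x,1])` (the min exists by right-continuity; `sInf` here). -/
def xiG (g : ℝ → ℝ) (x : ℝ) : ℝ := sInf {t | t ∈ I01 ∧ x ≤ g t}

/-- The `α`-cut `[A]_α` of a fuzzy set `A`. -/
def cut {X : Type*} (A : X → ℝ) (α : ℝ) : Set X := {x | α ≤ A x}

/-- The support of a fuzzy set. -/
def supp {X : Type*} [TopologicalSpace X] (A : X → ℝ) : Set X := closure {x | 0 < A x}

/-- The `g`-cut `[A]_α^g = {x ∈ supp A : g (A x) ≥ α}`. -/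
def gcut {X : Type*} [TopologicalSpace X] (g : ℝ → ℝ) (A : X → ℝ) (α : ℝ) : Set X :=
  {x | x ∈ supp A ∧ α ≤ g (A x)}

/-- `A ∈ F(X)`: an upper semicontinuous fuzzy set on `X`. -/
def IsFuzzy {X : Type*} [TopologicalSpace X] (A : X → ℝ) : Prop :=
  UpperSemicontinuous A ∧ ∀ x, A x ∈ I01

/-- `A ∈ F_0(X)`: a nonempty (not identically 0) upper semicontinuous fuzzy set. -/
def InF0 {X : Type*} [TopologicalSpace X] (A : X → ℝ) : Prop := IsFuzzy A ∧ ∃ x, A x ≠ 0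

/-- `A ∈ F^1(X)`: an upper semicontinuous fuzzy set attaining the value 1. -/
def InF1 {X : Type*} [TopologicalSpace X] (A : X → ℝ) : Prop := IsFuzzy A ∧ ∃ x, 1 ≤ A x

/-- The `g`-fuzzification `f̃_g(A)(x) = sup {g (A y) : y ∈ f⁻¹(x)}` (with `sup ∅ = 0`). -/
def fuzz {X : Type*} (f : X → X) (g : ℝ → ℝ) (A : X → ℝ) : X → ℝ :=
  fun x => sSup ((fun y => g (A y)) '' (f ⁻¹' {x}))

open Classical in
/-- Hausdorff metric, extended by `d_H(∅,∅) = 0` and `d_H(∅,A) = diam X`. -/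
def dH {X : Type*} [MetricSpace X] (A B : Set X) : ℝ :=
  if A = ∅ ∧ B = ∅ then 0
  else if A = ∅ ∨ B = ∅ then Metric.diam (Set.univ : Set X)
  else Metric.hausdorffDist A B

/-- The levelwise metric `d_∞(A,B) = sup {d_H([A]_α, [B]_α) : α ∈ (0,1]}`. -/
def dInfty {X : Type*} [MetricSpace X] (A B : X → ℝ) : ℝ :=
  sSup ((fun α => dH (cut A α) (cut B α)) '' Set.Ioc (0:ℝ) 1)

/-- `K(X)`: the hyperspace of nonempty compact subsets of `X`. -/
def Kc (X : Type*) [MetricSpace X] : Set (Set X) := {A | IsCompact A ∧ A.Nonempty}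

section Dyn

variable {Y : Type*}

/-- `U` is a (relatively) open subset of the space `(S, ρ)`. -/
def IsOpenIn (S : Set Y) (ρ : Y → Y → ℝ) (U : Set Y) : Prop :=
  U ⊆ S ∧ ∀ x ∈ U, ∃ ε > 0, ∀ y ∈ S, ρ x y < ε → y ∈ U

/-- Diameter of a set with respect to the distance function `ρ`. -/
def diamIn (ρ : Y → Y → ℝ) (U : Set Y) : ℝ := sSup (Set.image2 ρ U U)

/-- Sensitive dependence on initial conditions of `T` on the space `(S, ρ)`. -/
def SensitiveOn (S : Set Y) (ρ : Y → Y → ℝ) (T : Y → Y) : Prop :=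
  ∃ δ > 0, ∀ x ∈ S, ∀ ε > 0, ∃ y ∈ S, ρ x y < ε ∧ ∃ n : ℕ, δ < ρ (T^[n] x) (T^[n] y)

/-- `𝓕`-sensitivity of `T` on the space `(S, ρ)`. -/
def FSensitiveOn (S : Set Y) (ρ : Y → Y → ℝ) (T : Y → Y) (F : Set (Set ℕ)) : Prop :=
  ∃ ε > 0, ∀ U : Set Y, IsOpenIn S ρ U → U.Nonempty →
    {n : ℕ | ε < diamIn ρ (T^[n] '' U)} ∈ F

/-- Multi-sensitivity of `T` on the space `(S, ρ)`. -/
def MultiSensitiveOn (S : Set Y) (ρ : Y → Y → ℝ) (T : Y → Y) : Prop :=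
  ∃ ε > 0, ∀ (k : ℕ) (U : Fin k → Set Y),
    (∀ i, IsOpenIn S ρ (U i) ∧ (U i).Nonempty) →
    ∃ n : ℕ, ∀ i, ε < diamIn ρ (T^[n] '' U i)

/-- Topological transitivity of `T` on the space `(S, ρ)`. -/
def TransitiveOn (S : Set Y) (ρ : Y → Y → ℝ) (T : Y → Y) : Prop :=
  ∀ U V : Set Y, IsOpenIn S ρ U → U.Nonempty → IsOpenIn S ρ V → V.Nonempty →
    ∃ n : ℕ, ((T^[n] '' U) ∩ V).Nonempty

/-- Weak mixing: `T × T` is transitive on `(S × S, max-metric)`. -/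
def WeaklyMixingOn (S : Set Y) (ρ : Y → Y → ℝ) (T : Y → Y) : Prop :=
  TransitiveOn (S ×ˢ S) (fun p q => max (ρ p.1 q.1) (ρ p.2 q.2)) (Prod.map T T)

end Dyn

/-- A (proper) Furstenberg family on `ℤ⁺ = ℕ`. -/
def FurstenbergFamily (F : Set (Set ℕ)) : Prop :=
  (∀ F1 F2 : Set ℕ, F1 ∈ F → F1 ⊆ F2 → F2 ∈ F) ∧ Set.univ ∈ F ∧ ∅ ∉ F

section Hausdorff

variable {X : Type*} [MetricSpace X]

lemma dH_eq_hausdorffDist {K L : Set X} (hK : K.Nonempty) (hL : L.Nonempty) :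
    dH K L = hausdorffDist K L := by
  simp [dH, hK.ne_empty, hL.ne_empty]

variable [CompactSpace X]

lemma isBounded_of_compactSpace (K : Set X) : Bornology.IsBounded K :=
  isCompact_univ.isBounded.subset (subset_univ K)

lemma dH_le_diam_univ (K L : Set X) : dH K L ≤ diam (univ : Set X) := by
  unfold dH
  split_ifs with h₁ h₂
  · exact diam_nonneg
  · exact le_rfl
  · rw [not_or, ← ne_eq, ← ne_eq, ← nonempty_iff_ne_empty, ← nonempty_iff_ne_empty] at h₂
    exact (hausdorffDist_le_diam h₂.1 (isBounded_of_compactSpace K) h₂.2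
      (isBounded_of_compactSpace L)).trans
      (diam_mono (subset_univ _) (isBounded_of_compactSpace _))

lemma infDist_le_dH_left {K L : Set X} (hL : L.Nonempty) {x : X} (hx : x ∈ K) :
    infDist x L ≤ dH K L := by
  have hK : K.Nonempty := ⟨x, hx⟩
  rw [dH_eq_hausdorffDist hK hL]
  exact infDist_le_hausdorffDist_of_mem hx (hausdorffEDist_ne_top_of_nonempty_of_bounded hK hL
    (isBounded_of_compactSpace K) (isBounded_of_compactSpace L))

lemma infDist_le_dH_right {K L : Set X} (hK : K.Nonempty) {x : X} (hx : x ∈ L) :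
    infDist x K ≤ dH K L := by
  have hL : L.Nonempty := ⟨x, hx⟩
  rw [dH_eq_hausdorffDist hK hL, hausdorffDist_comm, ← dH_eq_hausdorffDist hL hK]
  exact infDist_le_dH_left hK hx

lemma dH_cut_le_dInfty (A B : X → ℝ) {α : ℝ} (hα : α ∈ Ioc (0 : ℝ) 1) :
    dH (cut A α) (cut B α) ≤ dInfty A B := by
  refine le_csSup ⟨diam (univ : Set X), ?_⟩ (mem_image_of_mem _ hα)
  rintro _ ⟨β, -, rfl⟩
  exact dH_le_diam_univ _ _

end Hausdorff

lemma dInfty_le {X : Type*} [MetricSpace X] {A B : X → ℝ} {r : ℝ}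
    (h : ∀ α ∈ Ioc (0 : ℝ) 1, dH (cut A α) (cut B α) ≤ r) : dInfty A B ≤ r :=
  csSup_le ((nonempty_Ioc.2 one_pos).image _) (by rintro _ ⟨α, hα, rfl⟩; exact h α hα)

lemma exists_lt_dH_cut_of_lt_dInfty {X : Type*} [MetricSpace X] {A B : X → ℝ} {δ : ℝ}
    (h : δ < dInfty A B) : ∃ α ∈ Ioc (0 : ℝ) 1, δ < dH (cut A α) (cut B α) := by
  obtain ⟨_, ⟨α, hα, rfl⟩, hlt⟩ := exists_lt_of_lt_csSup ((nonempty_Ioc.2 one_pos).image _) h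
  exact ⟨α, hα, hlt⟩

section Fuzzy

variable {X : Type*} [TopologicalSpace X] {A : X → ℝ}

lemma isFuzzy_of_isClosed_cut (hA : ∀ x, A x ∈ I01)
    (h : ∀ α ∈ Ioc (0 : ℝ) 1, IsClosed (cut A α)) : IsFuzzy A := by
  refine ⟨upperSemicontinuous_iff_isClosed_preimage.2 fun α => ?_, hA⟩
  change IsClosed (cut A α)
  rcases le_or_gt α 0 with h0 | h0
  · rw [show cut A α = univ from eq_univ_of_forall fun x => h0.trans (hA x).1]
    exact isClosed_univ
  rcases le_or_gt α 1 with h1 | h1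
  · exact h α ⟨h0, h1⟩
  · rw [show cut A α = ∅ from eq_empty_of_forall_notMem fun x hx =>
      (h1.trans_le hx).not_ge (hA x).2]
    exact isClosed_empty

lemma IsFuzzy.isClosed_cut (hA : IsFuzzy A) (α : ℝ) : IsClosed (cut A α) :=
  hA.1.isClosed_preimage α

lemma InF1.cut_nonempty (hA : InF1 A) {α : ℝ} (hα : α ≤ 1) : (cut A α).Nonempty :=
  let ⟨x, hx⟩ := hA.2
  ⟨x, hα.trans hx⟩

lemma IsFuzzy.fuzz_mem (hA : IsFuzzy A) (f : X → X) (x : X) : fuzz f id A x ∈ I01 := by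
  refine ⟨Real.sSup_nonneg ?_, Real.sSup_le ?_ zero_le_one⟩ <;> rintro _ ⟨y, -, rfl⟩
  · exact (hA.2 y).1
  · exact (hA.2 y).2

variable [T1Space X] [CompactSpace X] {f : X → X}

lemma IsFuzzy.cut_fuzz (hA : IsFuzzy A) (hf : Continuous f) {α : ℝ} (hα : 0 < α) :
    cut (fuzz f id A) α = f '' cut A α := by
  ext x
  constructor
  · intro (hx : α ≤ fuzz f id A x)
    rcases (f ⁻¹' {x}).eq_empty_or_nonempty with he | hne
    · rw [fuzz, he, image_empty, Real.sSup_empty] at hx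
      exact absurd hx hα.not_ge
    · obtain ⟨y, hy, hmax⟩ := (hA.1.upperSemicontinuousOn _).exists_isMaxOn hne
        (isClosed_singleton.preimage hf).isCompact
      refine ⟨y, hx.trans (csSup_le (hne.image _) ?_), hy⟩
      rintro _ ⟨z, hz, rfl⟩
      exact hmax hz
  · rintro ⟨y, hy, rfl⟩
    refine le_trans (show α ≤ A y from hy) (le_csSup ⟨1, ?_⟩ ⟨y, rfl, rfl⟩)
    rintro _ ⟨z, -, rfl⟩
    exact (hA.2 z).2

end Fuzzy

section Extension

variable {X : Type*} [TopologicalSpace X] [T2Space X] [CompactSpace X] {A : X → ℝ} {f : X → X}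

lemma IsFuzzy.fuzz (hA : IsFuzzy A) (hf : Continuous f) : IsFuzzy (fuzz f id A) :=
  isFuzzy_of_isClosed_cut (hA.fuzz_mem f) fun α hα => by
    rw [hA.cut_fuzz hf hα.1]
    exact hf.isClosedMap _ (hA.isClosed_cut α)

lemma IsFuzzy.cut_iterate_fuzz (hA : IsFuzzy A) (hf : Continuous f) {α : ℝ} (hα : 0 < α)
    (n : ℕ) : cut ((_root_.fuzz f id)^[n] A) α = (image f)^[n] (cut A α) := by
  induction n generalizing A with
  | zero => rfl
  | succ n ih =>
    rw [Function.iterate_succ_apply, Function.iterate_succ_apply, ih (hA.fuzz hf),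
      hA.cut_fuzz hf hα]

end Extension

open Classical in
/-- The fuzzy set with value `1` on `L` and `min A c` elsewhere. For `c < 1`, its `1`-cut is `L`. -/
def replaceTop {X : Type*} (A : X → ℝ) (L : Set X) (c : ℝ) : X → ℝ :=
  fun x => if x ∈ L then 1 else min (A x) c

lemma cut_replaceTop_of_le {X : Type*} (A : X → ℝ) (L : Set X) {c α : ℝ} (h : α ≤ c)
    (h1 : α ≤ 1) : cut (replaceTop A L c) α = cut A α ∪ L := by
  ext x
  by_cases hx : x ∈ L <;> simp [cut, replaceTop, hx, h, h1]

lemma cut_replaceTop_of_lt {X : Type*} (A : X → ℝ) (L : Set X) {c α : ℝ} (h : c < α)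
    (h1 : α ≤ 1) : cut (replaceTop A L c) α = L := by
  ext x
  by_cases hx : x ∈ L <;> simp [cut, replaceTop, hx, h.not_ge, h1]

lemma InF1.replaceTop {X : Type*} [TopologicalSpace X] {A : X → ℝ} (hA : InF1 A) {L : Set X}
    (hL : IsClosed L) (hne : L.Nonempty) {c : ℝ} (hc : c ∈ I01) : InF1 (replaceTop A L c) := by
  refine ⟨isFuzzy_of_isClosed_cut (fun x => ?_) fun α hα => ?_, ?_⟩
  · by_cases hx : x ∈ L
    · simp [_root_.replaceTop, hx, I01]
    · simpa [_root_.replaceTop, hx, I01] using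
        ⟨⟨(hA.1.2 x).1, hc.1⟩, Or.inl (hA.1.2 x).2⟩
  · rcases le_or_gt α c with h | h
    · rw [cut_replaceTop_of_le A L h hα.2]
      exact (hA.1.isClosed_cut α).union hL
    · rwa [cut_replaceTop_of_lt A L h hα.2]
  · obtain ⟨x, hx⟩ := hne
    exact ⟨x, by simp [_root_.replaceTop, hx]⟩

lemma isFuzzy_indicator {X : Type*} [TopologicalSpace X] {K : Set X} (hK : IsClosed K) :
    IsFuzzy (K.indicator (1 : X → ℝ)) := by
  refine ⟨(hK.upperSemicontinuous_indicator zero_le_one), fun x => ?_⟩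
  by_cases hx : x ∈ K <;> simp [hx, I01]

lemma cut_indicator {X : Type*} (K : Set X) {α : ℝ} (hα : α ∈ Ioc (0 : ℝ) 1) :
    cut (K.indicator (1 : X → ℝ)) α = K := by
  ext x
  by_cases hx : x ∈ K <;> simp [cut, hx, hα.1.not_ge, hα.2]

/-- The cuts of an upper semicontinuous fuzzy set converge to the `1`-cut as the level tends
to `1`. -/
lemma InF1.exists_level_infDist_le {X : Type*} [MetricSpace X] [CompactSpace X] {A : X → ℝ}
    (hA : InF1 A) {r : ℝ} (hr : 0 < r) :
    ∃ c : ℝ, 0 ≤ c ∧ c < 1 ∧ ∀ x, c < A x → infDist x (cut A 1) ≤ r := by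
  rcases {x | r ≤ infDist x (cut A 1)}.eq_empty_or_nonempty with he | hne
  · refine ⟨0, le_rfl, one_pos, fun x _ => le_of_not_ge fun hx => ?_⟩
    exact (he ▸ hx : x ∈ (∅ : Set X))
  · obtain ⟨m, hm, hmax⟩ := (hA.1.1.upperSemicontinuousOn _).exists_isMaxOn hne
      (isClosed_le continuous_const (continuous_infDist_pt _)).isCompact
    refine ⟨A m, (hA.1.2 m).1, lt_of_not_ge fun h1 => ?_, fun x hx => le_of_not_ge fun hx' => ?_⟩
    · exact hr.not_ge ((show r ≤ infDist m (cut A 1) from hm).trans_eq (infDist_zero_of_mem h1))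
    · exact hx.not_ge (hmax hx')

lemma dInfty_replaceTop_le {X : Type*} [MetricSpace X] [CompactSpace X] {A : X → ℝ}
    (hA : InF1 A) {L : Set X} (hL : L.Nonempty) {c r : ℝ} (hr : 0 ≤ r)
    (hc : ∀ x, c < A x → infDist x (cut A 1) ≤ r) :
    dInfty A (replaceTop A L c) ≤ r + dH (cut A 1) L := by
  have hK : (cut A 1).Nonempty := hA.cut_nonempty le_rfl
  have hd : 0 ≤ dH (cut A 1) L := infDist_nonneg.trans (infDist_le_dH_right hK hL.some_mem)
  refine dInfty_le fun α hα => ?_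
  have hAα := hA.cut_nonempty hα.2
  have hnear : ∀ x ∈ L, infDist x (cut A α) ≤ r + dH (cut A 1) L := fun x hx =>
    (infDist_le_infDist_of_subset (fun y hy => hα.2.trans hy) hK).trans
      ((infDist_le_dH_right hK hx).trans (le_add_of_nonneg_left hr))
  rcases le_or_gt α c with h | h
  · rw [cut_replaceTop_of_le A L h hα.2, dH_eq_hausdorffDist hAα (hAα.mono subset_union_left)]
    refine hausdorffDist_le_of_infDist (by positivity) (fun x hx => ?_) ?_
    · rw [infDist_zero_of_mem (mem_union_left L hx)]
      positivity
    · rintro x (hx | hx)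
      · rw [infDist_zero_of_mem hx]
        positivity
      · exact hnear x hx
  · rw [cut_replaceTop_of_lt A L h hα.2, dH_eq_hausdorffDist hAα hL]
    refine hausdorffDist_le_of_infDist (by positivity) (fun x hx => ?_) hnear
    have hfin := hausdorffEDist_ne_top_of_nonempty_of_bounded hK hL
      (isBounded_of_compactSpace _) (isBounded_of_compactSpace L)
    calc infDist x L ≤ infDist x (cut A 1) + hausdorffDist (cut A 1) L :=
          infDist_le_infDist_add_hausdorffDist hfin
      _ ≤ r + dH (cut A 1) L := by
          rw [dH_eq_hausdorffDist hK hL]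
          gcongr
          exact hc x (h.trans_le hx)

/-- `(K(X), f̄)` is sensitively dependent iff Zadeh's extension
`f̃ = f̃_id` is sensitively dependent on `(F^1(X), d_∞)`. -/
theorem stmt10 {X : Type*} [MetricSpace X] [CompactSpace X]
    (f : X → X) (hf : Continuous f) :
    SensitiveOn (Kc X) dH (Set.image f) ↔
      SensitiveOn {A : X → ℝ | InF1 A} dInfty (fuzz f id) := by
  constructor
  · rintro ⟨δ, hδ, hsens⟩
    refine ⟨δ, hδ, fun A (hA : InF1 A) ε hε => ?_⟩
    obtain ⟨L, ⟨hLc, hL⟩, hlt, n, hn⟩ := hsens (cut A 1)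
      ⟨(hA.1.isClosed_cut 1).isCompact, hA.cut_nonempty le_rfl⟩ (ε / 2) (half_pos hε)
    obtain ⟨c, hc0, hc1, hc⟩ := hA.exists_level_infDist_le (half_pos hε)
    have hB : InF1 (replaceTop A L c) := hA.replaceTop hLc.isClosed hL ⟨hc0, hc1.le⟩
    refine ⟨replaceTop A L c, hB, ?_, n, hn.trans_le ?_⟩
    · have := dInfty_replaceTop_le hA hL (half_pos hε).le hc
      linarith
    · have := dH_cut_le_dInfty ((fuzz f id)^[n] A) ((fuzz f id)^[n] (replaceTop A L c))
        (right_mem_Ioc.2 one_pos)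
      rwa [hA.1.cut_iterate_fuzz hf one_pos, hB.1.cut_iterate_fuzz hf one_pos,
        cut_replaceTop_of_lt A L hc1 le_rfl] at this
  · rintro ⟨δ, hδ, hsens⟩
    refine ⟨δ, hδ, fun K ⟨hKc, hK⟩ ε hε => ?_⟩
    have hA := isFuzzy_indicator hKc.isClosed
    obtain ⟨B, hB, hlt, n, hn⟩ := hsens (K.indicator 1)
      ⟨hA, hK.some, by simp [hK.some_mem]⟩ ε hε
    obtain ⟨α, hα, hn⟩ := exists_lt_dH_cut_of_lt_dInfty hn
    rw [hA.cut_iterate_fuzz hf hα.1, hB.1.cut_iterate_fuzz hf hα.1, cut_indicator K hα] at hn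
    refine ⟨cut B α, ⟨(hB.1.isClosed_cut α).isCompact, hB.cut_nonempty hα.2⟩, ?_, n, hn⟩
    simpa only [cut_indicator K hα] using (dH_cut_le_dInfty (K.indicator 1) B hα).trans_lt hlt
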